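/- Suppose K ≥ 0 and ‖x_{i,c}‖ ≤ K for all i, c, and define iterates W_1 = 0 ∈ H^C and W_{t+1} = W_t − (1/(λt)) ∇(W_t) for t ≥ 1, where ∇(W) = (λ w_1 + v_1(W), …, λ w_C + v_C(W)) is the explicit subgradient of L at W. Then for every positive integer T, min_{1 ≤ t ≤ T} L(W_t) ≤ inf_{W ∈ H^C} L(W) + 8 C K² (1 + ln T)/(λ T). In particular, for every σ > 0 there exists T = O(C K² /(λ σ)) (up to the logarithmic factor 1 + ln T) such that the subgradient descent step achieves a solution within σ of optimal. -/

import Mathlib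

open scoped RealInnerProductSpace
open Finset

/-- The regularized surrogate loss `L` (Eq. 5 of the paper). -/
noncomputable def surrogateLoss {H : Type*} [NormedAddCommGroup H] [InnerProductSpace ℝ H]
    {n C : ℕ} (lam : ℝ) (Yp : Fin n → Finset (Fin C)) (x : Fin n → Fin C → H)
    (W : Fin C → H) : ℝ :=
  lam / 2 * ∑ c, ‖W c‖ ^ 2 +
    (1 / (n : ℝ)) * ∑ i, (
      (1 / ((Yp i).card : ℝ) ^ 2) * ∑ p ∈ Yp i, max 0 (1 - ⟪W p, x i p⟫) +
      (1 / (((Yp i)ᶜ).card : ℝ) ^ 2) * ∑ q ∈ (Yp i)ᶜ, max 0 (1 + ⟪W q, x i q⟫) +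
      (1 / (((Yp i).card : ℝ) * (((Yp i)ᶜ).card : ℝ))) *
        ∑ p ∈ Yp i, ∑ q ∈ (Yp i)ᶜ, max 0 (2 + ⟪W q, x i q⟫ - ⟪W p, x i p⟫))

open scoped Classical in
/-- The coefficient `β_{i,c}(W)` of `x_{i,c}` in the non-regularization part of
the subgradient of `L` at `W`. -/
noncomputable def betaCoeff {H : Type*} [NormedAddCommGroup H] [InnerProductSpace ℝ H]
    {n C : ℕ} (Yp : Fin n → Finset (Fin C)) (x : Fin n → Fin C → H)
    (W : Fin C → H) (i : Fin n) (c : Fin C) : ℝ :=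
  -(1 / ((Yp i).card : ℝ) ^ 2) * (if c ∈ Yp i then 1 else 0) *
      (if ⟪W c, x i c⟫ ≤ 1 then 1 else 0)
  + (1 / (((Yp i)ᶜ).card : ℝ) ^ 2) * (if c ∈ (Yp i)ᶜ then 1 else 0) *
      (if (-1 : ℝ) ≤ ⟪W c, x i c⟫ then 1 else 0)
  + (1 / (((Yp i).card : ℝ) * (((Yp i)ᶜ).card : ℝ))) *
      ((if c ∈ (Yp i)ᶜ then 1 else 0) *
          ∑ p ∈ Yp i, (if ⟪W p, x i p⟫ ≤ 2 + ⟪W c, x i c⟫ then (1 : ℝ) else 0)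
        - (if c ∈ Yp i then 1 else 0) *
          ∑ q ∈ (Yp i)ᶜ, (if ⟪W c, x i c⟫ ≤ 2 + ⟪W q, x i q⟫ then (1 : ℝ) else 0))

/-- The non-regularization part `v_c(W)` of the subgradient of `L` at `W`. -/
noncomputable def vPart {H : Type*} [NormedAddCommGroup H] [InnerProductSpace ℝ H]
    {n C : ℕ} (Yp : Fin n → Finset (Fin C)) (x : Fin n → Fin C → H)
    (W : Fin C → H) (c : Fin C) : H :=
  (1 / (n : ℝ)) • ∑ i, betaCoeff Yp x W i c • x i c

/-- The explicit subgradient `∇(W)` of `L` at `W`, with components `λ w_c + v_c(W)`. -/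
noncomputable def gradL {H : Type*} [NormedAddCommGroup H] [InnerProductSpace ℝ H]
    {n C : ℕ} (lam : ℝ) (Yp : Fin n → Finset (Fin C)) (x : Fin n → Fin C → H)
    (W : Fin C → H) : Fin C → H :=
  fun c => lam • W c + vPart Yp x W c

lemma aux_h1 (a b : ℝ) : max 0 (1 - a) + (-(if a ≤ 1 then (1:ℝ) else 0) * (b - a)) ≤ max 0 (1 - b) := by
  split_ifs with h
  · rw [max_eq_right (by linarith)]
    have := le_max_right 0 (1 - b)
    linarith
  · rw [max_eq_left (by linarith)]
    have := le_max_left 0 (1 - b)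
    linarith

lemma aux_h2 (a b : ℝ) : max 0 (1 + a) + ((if -1 ≤ a then (1:ℝ) else 0) * (b - a)) ≤ max 0 (1 + b) := by
  split_ifs with h
  · rw [max_eq_right (by linarith)]
    have := le_max_right 0 (1 + b)
    linarith
  · rw [max_eq_left (by linarith)]
    have := le_max_left 0 (1 + b)
    linarith

lemma aux_h3 (a b a' b' : ℝ) : max 0 (2 + a - a') +
    ((if a' ≤ 2 + a then (1:ℝ) else 0) * (b - a) - (if a' ≤ 2 + a then (1:ℝ) else 0) * (b' - a'))
      ≤ max 0 (2 + b - b') := by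
  split_ifs with h
  · rw [max_eq_right (by linarith)]
    have := le_max_right 0 (2 + b - b')
    linarith
  · rw [max_eq_left (by linarith)]
    have := le_max_left 0 (2 + b - b')
    linarith

lemma aux_ite {C : ℕ} (s : Finset (Fin C)) (f : Fin C → ℝ) :
    ∑ c, (if c ∈ s then (1:ℝ) else 0) * f c = ∑ c ∈ s, f c := by
  simp [Finset.sum_ite_mem]

open scoped Classical in
lemma aux_beta_sum {H : Type*} [NormedAddCommGroup H] [InnerProductSpace ℝ H]
    {n C : ℕ} (Yp : Fin n → Finset (Fin C)) (x : Fin n → Fin C → H)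
    (W : Fin C → H) (i : Fin n) (d : Fin C → ℝ) :
    ∑ c, betaCoeff Yp x W i c * d c =
      (1 / ((Yp i).card : ℝ) ^ 2) * ∑ p ∈ Yp i, (-(if ⟪W p, x i p⟫ ≤ 1 then (1:ℝ) else 0) * d p)
      + (1 / (((Yp i)ᶜ).card : ℝ) ^ 2) *
          ∑ q ∈ (Yp i)ᶜ, ((if -1 ≤ ⟪W q, x i q⟫ then (1:ℝ) else 0) * d q)
      + (1 / (((Yp i).card : ℝ) * (((Yp i)ᶜ).card : ℝ))) *
        ∑ p ∈ Yp i, ∑ q ∈ (Yp i)ᶜ,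
          ((if ⟪W p, x i p⟫ ≤ 2 + ⟪W q, x i q⟫ then (1:ℝ) else 0) * d q
            - (if ⟪W p, x i p⟫ ≤ 2 + ⟪W q, x i q⟫ then (1:ℝ) else 0) * d p) := by
  have e : ∀ c, betaCoeff Yp x W i c * d c =
      (1 / ((Yp i).card : ℝ) ^ 2) *
        ((if c ∈ Yp i then (1:ℝ) else 0) * (-(if ⟪W c, x i c⟫ ≤ 1 then (1:ℝ) else 0) * d c))
      + (1 / (((Yp i)ᶜ).card : ℝ) ^ 2) *
        ((if c ∈ (Yp i)ᶜ then (1:ℝ) else 0) * ((if -1 ≤ ⟪W c, x i c⟫ then (1:ℝ) else 0) * d c))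
      + (1 / (((Yp i).card : ℝ) * (((Yp i)ᶜ).card : ℝ))) *
        ((if c ∈ (Yp i)ᶜ then (1:ℝ) else 0) *
          ((∑ p ∈ Yp i, (if ⟪W p, x i p⟫ ≤ 2 + ⟪W c, x i c⟫ then (1 : ℝ) else 0)) * d c))
      - (1 / (((Yp i).card : ℝ) * (((Yp i)ᶜ).card : ℝ))) *
        ((if c ∈ Yp i then (1:ℝ) else 0) *
          ((∑ q ∈ (Yp i)ᶜ, (if ⟪W c, x i c⟫ ≤ 2 + ⟪W q, x i q⟫ then (1 : ℝ) else 0)) * d c)) := by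
    intro c
    unfold betaCoeff
    ring
  simp_rw [e]
  rw [Finset.sum_sub_distrib, Finset.sum_add_distrib, Finset.sum_add_distrib]
  simp_rw [← Finset.mul_sum]
  rw [aux_ite, aux_ite, aux_ite, aux_ite]
  simp_rw [Finset.sum_sub_distrib, Finset.sum_mul]
  rw [Finset.sum_comm (s := (Yp i)ᶜ)]
  ring

lemma aux_sub {H : Type*} [NormedAddCommGroup H] [InnerProductSpace ℝ H]
    {n C : ℕ} (Yp : Fin n → Finset (Fin C)) (x : Fin n → Fin C → H)
    (W W' : Fin C → H) (i : Fin n) :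
    ((1 / ((Yp i).card : ℝ) ^ 2) * ∑ p ∈ Yp i, max 0 (1 - ⟪W p, x i p⟫) +
      (1 / (((Yp i)ᶜ).card : ℝ) ^ 2) * ∑ q ∈ (Yp i)ᶜ, max 0 (1 + ⟪W q, x i q⟫) +
      (1 / (((Yp i).card : ℝ) * (((Yp i)ᶜ).card : ℝ))) *
        ∑ p ∈ Yp i, ∑ q ∈ (Yp i)ᶜ, max 0 (2 + ⟪W q, x i q⟫ - ⟪W p, x i p⟫))
    + ∑ c, betaCoeff Yp x W i c * (⟪W' c, x i c⟫ - ⟪W c, x i c⟫) ≤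
    ((1 / ((Yp i).card : ℝ) ^ 2) * ∑ p ∈ Yp i, max 0 (1 - ⟪W' p, x i p⟫) +
      (1 / (((Yp i)ᶜ).card : ℝ) ^ 2) * ∑ q ∈ (Yp i)ᶜ, max 0 (1 + ⟪W' q, x i q⟫) +
      (1 / (((Yp i).card : ℝ) * (((Yp i)ᶜ).card : ℝ))) *
        ∑ p ∈ Yp i, ∑ q ∈ (Yp i)ᶜ, max 0 (2 + ⟪W' q, x i q⟫ - ⟪W' p, x i p⟫)) := by
  classical
  rw [aux_beta_sum]
  have a1 := mul_le_mul_of_nonneg_left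
    (Finset.sum_le_sum (s := Yp i) fun p _ => aux_h1 ⟪W p, x i p⟫ ⟪W' p, x i p⟫)
    (show (0:ℝ) ≤ 1 / ((Yp i).card : ℝ) ^ 2 by positivity)
  have a2 := mul_le_mul_of_nonneg_left
    (Finset.sum_le_sum (s := (Yp i)ᶜ) fun p _ => aux_h2 ⟪W p, x i p⟫ ⟪W' p, x i p⟫)
    (show (0:ℝ) ≤ 1 / (((Yp i)ᶜ).card : ℝ) ^ 2 by positivity)
  have a3 := mul_le_mul_of_nonneg_left
    (Finset.sum_le_sum (s := Yp i) fun p _ => Finset.sum_le_sum (s := (Yp i)ᶜ) fun q _ =>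
      aux_h3 ⟪W q, x i q⟫ ⟪W' q, x i q⟫ ⟪W p, x i p⟫ ⟪W' p, x i p⟫)
    (show (0:ℝ) ≤ 1 / (((Yp i).card : ℝ) * (((Yp i)ᶜ).card : ℝ)) by positivity)
  rw [Finset.sum_add_distrib, mul_add] at a1 a2
  simp_rw [Finset.sum_add_distrib] at a3
  rw [mul_add] at a3
  linarith

lemma aux_bound (A B S : ℝ) (hA : 1 ≤ A) (hB : 1 ≤ B) (hS0 : 0 ≤ S) (hS : S ≤ B)
    (e : ℝ) (he0 : 0 ≤ e) (he : e ≤ 1) :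
    0 ≤ 1 / A ^ 2 * e + 1 / (A * B) * S ∧ 1 / A ^ 2 * e + 1 / (A * B) * S ≤ 2 := by
  constructor
  · positivity
  · have h1 : 1 / A ^ 2 ≤ 1 := by
      rw [div_le_one (by positivity)]; nlinarith
    have h2 : 1 / (A * B) * S ≤ 1 := by
      rw [one_div, inv_mul_le_iff₀ (by positivity)]; nlinarith
    have h3 : 0 ≤ 1 / A ^ 2 := by positivity
    nlinarith

lemma aux_beta_abs {H : Type*} [NormedAddCommGroup H] [InnerProductSpace ℝ H]
    {n C : ℕ} (Yp : Fin n → Finset (Fin C))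
    (hpos : ∀ i, (Yp i).Nonempty) (hneg : ∀ i, ((Yp i)ᶜ).Nonempty)
    (x : Fin n → Fin C → H) (W : Fin C → H) (i : Fin n) (c : Fin C) :
    |betaCoeff Yp x W i c| ≤ 2 := by
  classical
  have hA : (1:ℝ) ≤ (Yp i).card := by exact_mod_cast (hpos i).card_pos
  have hB : (1:ℝ) ≤ ((Yp i)ᶜ).card := by exact_mod_cast (hneg i).card_pos
  have hs : ∀ (s : Finset (Fin C)) (P : Fin C → Prop) [DecidablePred P],
      0 ≤ ∑ q ∈ s, (if P q then (1:ℝ) else 0) ∧ ∑ q ∈ s, (if P q then (1:ℝ) else 0) ≤ s.card := by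
    intro s P _
    rw [Finset.sum_boole]
    exact ⟨by positivity, by exact_mod_cast Finset.card_filter_le _ _⟩
  have hi : ∀ (P : Prop) [Decidable P], 0 ≤ (if P then (1:ℝ) else 0) ∧ (if P then (1:ℝ) else 0) ≤ 1 := by
    intro P _
    split_ifs <;> norm_num
  by_cases hc : c ∈ Yp i
  · have hc' : c ∉ (Yp i)ᶜ := by simpa using hc
    obtain ⟨b1, b2⟩ := hs (Yp i)ᶜ (fun q => ⟪W c, x i c⟫ ≤ 2 + ⟪W q, x i q⟫)
    obtain ⟨d1, d2⟩ := hi (⟪W c, x i c⟫ ≤ 1)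
    obtain ⟨k1, k2⟩ := aux_bound _ _ _ hA hB b1 b2 _ d1 d2
    have : betaCoeff Yp x W i c = -(1 / ((Yp i).card : ℝ) ^ 2 * (if ⟪W c, x i c⟫ ≤ 1 then (1:ℝ) else 0)
      + 1 / (((Yp i).card : ℝ) * (((Yp i)ᶜ).card : ℝ)) *
        ∑ q ∈ (Yp i)ᶜ, (if ⟪W c, x i c⟫ ≤ 2 + ⟪W q, x i q⟫ then (1 : ℝ) else 0)) := by
      unfold betaCoeff
      rw [if_pos hc, if_neg hc']
      ring
    rw [this, abs_neg, abs_of_nonneg k1]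
    exact k2
  · have hc' : c ∈ (Yp i)ᶜ := by simpa using hc
    obtain ⟨b1, b2⟩ := hs (Yp i) (fun p => ⟪W p, x i p⟫ ≤ 2 + ⟪W c, x i c⟫)
    obtain ⟨d1, d2⟩ := hi (-1 ≤ ⟪W c, x i c⟫)
    obtain ⟨k1, k2⟩ := aux_bound _ _ _ hB hA b1 b2 _ d1 d2
    have : betaCoeff Yp x W i c = (1 / (((Yp i)ᶜ).card : ℝ) ^ 2 * (if -1 ≤ ⟪W c, x i c⟫ then (1:ℝ) else 0)
      + 1 / ((((Yp i)ᶜ).card : ℝ) * ((Yp i).card : ℝ)) *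
        ∑ p ∈ Yp i, (if ⟪W p, x i p⟫ ≤ 2 + ⟪W c, x i c⟫ then (1 : ℝ) else 0)) := by
      unfold betaCoeff
      rw [if_neg hc, if_pos hc']
      ring
    rw [this, abs_of_nonneg k1]
    exact k2

lemma aux_v {H : Type*} [NormedAddCommGroup H] [InnerProductSpace ℝ H]
    {n C : ℕ} (hn : 0 < n) (Yp : Fin n → Finset (Fin C))
    (hpos : ∀ i, (Yp i).Nonempty) (hneg : ∀ i, ((Yp i)ᶜ).Nonempty)
    (x : Fin n → Fin C → H) (K : ℝ) (hx : ∀ i c, ‖x i c‖ ≤ K)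
    (W : Fin C → H) (c : Fin C) :
    ‖vPart Yp x W c‖ ≤ 2 * K := by
  have hn' : (0:ℝ) < n := by exact_mod_cast hn
  unfold vPart
  rw [norm_smul, Real.norm_of_nonneg (by positivity), one_div, inv_mul_le_iff₀ hn']
  calc _ ≤ ∑ i : Fin n, ‖betaCoeff Yp x W i c • x i c‖ := norm_sum_le _ _
    _ ≤ ∑ i : Fin n, 2 * K := by
      refine Finset.sum_le_sum fun i _ => ?_
      rw [norm_smul]
      exact mul_le_mul (aux_beta_abs Yp hpos hneg x W i c) (hx i c) (norm_nonneg _) (by norm_num)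
    _ = _ := by simp

lemma aux_strong {H : Type*} [NormedAddCommGroup H] [InnerProductSpace ℝ H]
    {n C : ℕ} (lam : ℝ) (Yp : Fin n → Finset (Fin C))
    (x : Fin n → Fin C → H) (W W' : Fin C → H) :
    surrogateLoss lam Yp x W + ∑ c, ⟪gradL lam Yp x W c, W' c - W c⟫
      + lam / 2 * ∑ c, ‖W c - W' c‖ ^ 2 ≤ surrogateLoss lam Yp x W' := by
  have e1 : ∑ c, ⟪gradL lam Yp x W c, W' c - W c⟫ =
      lam * ∑ c, ⟪W c, W' c - W c⟫ +
      1 / (n:ℝ) * ∑ i, ∑ c, betaCoeff Yp x W i c * (⟪W' c, x i c⟫ - ⟪W c, x i c⟫) := by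
    rw [Finset.sum_comm, Finset.mul_sum, Finset.mul_sum, ← Finset.sum_add_distrib]
    refine Finset.sum_congr rfl fun c _ => ?_
    unfold gradL vPart
    rw [inner_add_left, real_inner_smul_left, real_inner_smul_left, sum_inner]
    congr 2
    refine Finset.sum_congr rfl fun i _ => ?_
    rw [real_inner_smul_left, real_inner_comm, inner_sub_left]
  have e2 : lam / 2 * ∑ c, ‖W c‖ ^ 2 + lam * ∑ c, ⟪W c, W' c - W c⟫
      + lam / 2 * ∑ c, ‖W c - W' c‖ ^ 2 = lam / 2 * ∑ c, ‖W' c‖ ^ 2 := by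
    simp_rw [Finset.mul_sum]
    rw [← Finset.sum_add_distrib, ← Finset.sum_add_distrib]
    refine Finset.sum_congr rfl fun c _ => ?_
    rw [norm_sub_sq_real, inner_sub_right, real_inner_self_eq_norm_sq]
    ring
  have e3 := mul_le_mul_of_nonneg_left
    (Finset.sum_le_sum (s := Finset.univ) fun i _ => aux_sub Yp x W W' i)
    (show (0:ℝ) ≤ 1 / (n:ℝ) by positivity)
  rw [Finset.sum_add_distrib, mul_add] at e3
  rw [e1]
  unfold surrogateLoss
  linarith

/-- Core quantitative content of Theorem 1: subgradient descent from `0` on the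
surrogate loss `L` satisfies
`min_{1 ≤ t ≤ T} L(W_t) ≤ inf_W L(W) + 8 C K² (1 + ln T)/(λ T)`. -/
theorem stmt_12 {H : Type*} [NormedAddCommGroup H] [InnerProductSpace ℝ H]
    (n C : ℕ) (hn : 0 < n) (hC : 0 < C)
    (lam : ℝ) (hlam : 0 < lam)
    (Yp : Fin n → Finset (Fin C))
    (hpos : ∀ i, (Yp i).Nonempty) (hneg : ∀ i, ((Yp i)ᶜ).Nonempty)
    (x : Fin n → Fin C → H)
    (K : ℝ) (hK : 0 ≤ K) (hx : ∀ i c, ‖x i c‖ ≤ K)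
    (Wseq : ℕ → Fin C → H)
    (h1 : Wseq 1 = 0)
    (hrec : ∀ t, 1 ≤ t →
      Wseq (t + 1) = Wseq t - (1 / (lam * (t : ℝ))) • gradL lam Yp x (Wseq t))
    (T : ℕ) (hT : 0 < T) :
    ∃ t ∈ Finset.Icc 1 T, ∀ W' : Fin C → H,
      surrogateLoss lam Yp x (Wseq t)
        ≤ surrogateLoss lam Yp x W'
            + 8 * C * K ^ 2 * (1 + Real.log T) / (lam * T) := by
  have hv := aux_v hn Yp hpos hneg x K hx
  -- norm bound on the iterates
  have hW : ∀ t, 1 ≤ t → ∀ c, ‖Wseq t c‖ ≤ 2 * K / lam := by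
    intro t ht
    induction t, ht using Nat.le_induction with
    | base => intro c; rw [h1]; simp; positivity
    | succ t ht ih =>
      intro c
      have ht' : (1:ℝ) ≤ t := by exact_mod_cast ht
      have e : Wseq (t + 1) c = (1 - 1 / (t:ℝ)) • Wseq t c
          - (1 / (lam * t)) • vPart Yp x (Wseq t) c := by
        rw [hrec t ht]
        simp only [Pi.sub_apply, Pi.smul_apply, gradL, smul_add, smul_smul]
        rw [show 1 / (lam * (t:ℝ)) * lam = 1 / t by field_simp, sub_smul, one_smul]
        abel
      rw [e]
      refine (norm_sub_le _ _).trans ?_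
      have h0 : 0 ≤ 1 - 1 / (t:ℝ) := by
        rw [sub_nonneg, div_le_one (by positivity)]; exact ht'
      rw [norm_smul, norm_smul, Real.norm_of_nonneg h0, Real.norm_of_nonneg (by positivity)]
      calc _ ≤ (1 - 1 / (t:ℝ)) * (2 * K / lam) + 1 / (lam * t) * (2 * K) := by
            gcongr
            · exact ih c
            · exact hv _ c
        _ = 2 * K / lam := by field_simp; ring
  have hG : ∀ t, 1 ≤ t → ∑ c, ‖gradL lam Yp x (Wseq t) c‖ ^ 2 ≤ 16 * C * K ^ 2 := by
    intro t ht
    calc _ ≤ ∑ c : Fin C, (4 * K) ^ 2 := by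
          refine Finset.sum_le_sum fun c _ => ?_
          gcongr
          unfold gradL
          refine (norm_add_le _ _).trans ?_
          rw [norm_smul, Real.norm_of_nonneg hlam.le]
          have a := hv (Wseq t) c
          have b := mul_le_mul_of_nonneg_left (hW t ht c) hlam.le
          rw [mul_div_cancel₀ _ hlam.ne'] at b
          linarith
      _ = _ := by simp; ring
  have hstep : ∀ W' : Fin C → H, ∀ t, 1 ≤ t →
      surrogateLoss lam Yp x (Wseq t) - surrogateLoss lam Yp x W' ≤
        lam / 2 * (((t:ℝ) - 1) * ∑ c, ‖Wseq t c - W' c‖ ^ 2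
          - t * ∑ c, ‖Wseq (t + 1) c - W' c‖ ^ 2) + 8 * C * K ^ 2 / lam * (t:ℝ)⁻¹ := by
    intro W' t ht
    have ht' : (0:ℝ) < t := by exact_mod_cast ht
    have s := aux_strong lam Yp x (Wseq t) W'
    have e : ∑ c, ‖Wseq (t + 1) c - W' c‖ ^ 2 = ∑ c, ‖Wseq t c - W' c‖ ^ 2
        + 2 * (1 / (lam * t)) * ∑ c, ⟪gradL lam Yp x (Wseq t) c, W' c - Wseq t c⟫
        + (1 / (lam * t)) ^ 2 * ∑ c, ‖gradL lam Yp x (Wseq t) c‖ ^ 2 := by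
      simp_rw [Finset.mul_sum]
      rw [← Finset.sum_add_distrib, ← Finset.sum_add_distrib]
      refine Finset.sum_congr rfl fun c _ => ?_
      rw [hrec t ht]
      simp only [Pi.sub_apply, Pi.smul_apply]
      rw [sub_right_comm, norm_sub_sq_real, norm_smul, real_inner_smul_right,
        Real.norm_of_nonneg (by positivity), real_inner_comm,
        ← neg_sub (W' c) (Wseq t c), inner_neg_right]
      ring
    have g := mul_le_mul_of_nonneg_left (hG t ht) (show 0 ≤ 1 / (2 * lam * t) by positivity)
    rw [e]
    set G := ∑ c, ‖gradL lam Yp x (Wseq t) c‖ ^ 2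
    set D := ∑ c, ‖Wseq t c - W' c‖ ^ 2
    set P := ∑ c, ⟪gradL lam Yp x (Wseq t) c, W' c - Wseq t c⟫
    have r : lam / 2 * (((t:ℝ) - 1) * D - t * (D + 2 * (1 / (lam * t)) * P + (1 / (lam * t)) ^ 2 * G))
        = - (lam / 2 * D) - P - 1 / (2 * lam * t) * G := by
      field_simp
      ring
    have r2 : 1 / (2 * lam * t) * (16 * C * K ^ 2) = 8 * C * K ^ 2 / lam * (t:ℝ)⁻¹ := by
      field_simp
      ring
    rw [r]
    linarith
  have hsum : ∀ W' : Fin C → H, ∀ N : ℕ,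
      ∑ t ∈ Finset.range N, (surrogateLoss lam Yp x (Wseq (t + 1)) - surrogateLoss lam Yp x W') ≤
        - (lam / 2 * (N * ∑ c, ‖Wseq (N + 1) c - W' c‖ ^ 2))
          + 8 * C * K ^ 2 / lam * ∑ t ∈ Finset.range N, (((t + 1 : ℕ) : ℝ))⁻¹ := by
    intro W' N
    induction N with
    | zero => simp
    | succ N ih =>
      rw [Finset.sum_range_succ, Finset.sum_range_succ, mul_add]
      have := hstep W' (N + 1) (by omega)
      push_cast at this ih ⊢
      linarith
  obtain ⟨t, ht, hmin⟩ := Finset.exists_min_image (Finset.Icc 1 T)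
    (fun t => surrogateLoss lam Yp x (Wseq t)) ⟨1, by simp; omega⟩
  refine ⟨t, ht, fun W' => ?_⟩
  have hT' : (0:ℝ) < T := by exact_mod_cast hT
  have s := hsum W' T
  have l : (T:ℝ) * (surrogateLoss lam Yp x (Wseq t) - surrogateLoss lam Yp x W') ≤
      ∑ t ∈ Finset.range T, (surrogateLoss lam Yp x (Wseq (t + 1)) - surrogateLoss lam Yp x W') := by
    rw [← nsmul_eq_mul]
    have := Finset.card_nsmul_le_sum (Finset.range T)
      (fun t => surrogateLoss lam Yp x (Wseq (t + 1)) - surrogateLoss lam Yp x W')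
      (surrogateLoss lam Yp x (Wseq t) - surrogateLoss lam Yp x W') (by
        intro k hk
        have := hmin (k + 1) (by simp at hk ⊢; omega)
        linarith)
    simpa using this
  have hh : ∑ t ∈ Finset.range T, (((t + 1 : ℕ) : ℝ))⁻¹ ≤ 1 + Real.log T := by
    have := harmonic_le_one_add_log T
    unfold harmonic at this
    push_cast at this ⊢
    exact this
  have p := mul_le_mul_of_nonneg_left hh (show 0 ≤ 8 * C * K ^ 2 / lam by positivity)
  have q : 0 ≤ lam / 2 * (T * ∑ c, ‖Wseq (T + 1) c - W' c‖ ^ 2) := by positivity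
  have r : (surrogateLoss lam Yp x (Wseq t) - surrogateLoss lam Yp x W') ≤
      8 * C * K ^ 2 * (1 + Real.log T) / (lam * T) := by
    rw [← div_div, le_div_iff₀ hT', mul_comm]
    calc _ ≤ 8 * C * K ^ 2 / lam * (1 + Real.log T) := by linarith
      _ = _ := by ring
  linarith
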